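/- arXiv:2409.05355 — 2 statements merged into one kernel-verified Lean document; each statement's English description precedes it below -/
import Mathlib

section
/- Let T > 0, τ ∈ (0,1], let α̲ > 0, and let α : [0,T] → ℝ be integrable with α(r) ≥ α̲ for almost every r ∈ [0,T]. Set C_∞ = 1 + (1 − exp(−α̲ T))⁻¹ and C₁ = C_∞/α̲. Then the kernel Ψ satisfies 0 ≤ Ψ(s,t) ≤ C_∞ for all s, t ∈ [0,T], and ∫₀ᵀ Ψ(s,t) ds ≤ C₁ τ for every t ∈ [0,T]. -/
open MeasureTheory Set

/-- An integrable function bounded below by `a` almost everywhere on `[0, T]` has integral at least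
`a * (t - s)` over any subinterval `[s, t]`. -/
theorem mul_sub_le_intervalIntegral_of_ae_le {T a s t : ℝ} {f : ℝ → ℝ}
    (hf : IntegrableOn f (Icc 0 T) volume)
    (ha : ∀ᵐ r ∂(volume.restrict (Icc (0:ℝ) T)), a ≤ f r)
    (hs : 0 ≤ s) (hst : s ≤ t) (ht : t ≤ T) :
    a * (t - s) ≤ ∫ r in s..t, f r := by
  have hsub : Icc s t ⊆ Icc 0 T := Icc_subset_Icc hs ht
  have hfi : IntervalIntegrable f volume s t :=
    (intervalIntegrable_iff_integrableOn_Icc_of_le hst).2 (hf.mono_set hsub)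
  have h := intervalIntegral.integral_mono_ae_restrict (μ := volume) hst
    (intervalIntegrable_const (c := a)) hfi (ae_restrict_of_ae_restrict_of_subset hsub ha)
  rw [intervalIntegral.integral_const, smul_eq_mul] at h
  linarith

theorem intervalIntegral_exp_neg_mul_sub_le {k : ℝ} (hk : 0 < k) (t : ℝ) :
    ∫ s in (0:ℝ)..t, Real.exp (-(k * (t - s))) ≤ 1 / k := by
  have hderiv : ∀ s ∈ uIcc 0 t,
      HasDerivAt (fun s => Real.exp (-(k * (t - s))) / k) (Real.exp (-(k * (t - s)))) s := by
    intro s _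
    have h : HasDerivAt (fun s => Real.exp (-(k * (t - s))) / k)
        (Real.exp (-(k * (t - s))) * -(k * -1) / k) s :=
      ((((hasDerivAt_id s).const_sub t).const_mul k).fun_neg.exp).div_const k
    rwa [mul_neg_one, neg_neg, mul_div_cancel_right₀ _ hk.ne'] at h
  rw [intervalIntegral.integral_eq_sub_of_hasDerivAt hderiv
    (Continuous.intervalIntegrable (by fun_prop) _ _)]
  have h : 0 ≤ Real.exp (-(k * (t - 0))) / k := by positivity
  simp only [sub_self, mul_zero, neg_zero, Real.exp_zero] at h ⊢
  linarith

/-- bounds on the periodic solution kernel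
`Ψ(s,t) = Φ(s,T)·Φ(0,t)/(1 − Φ(0,T)) + 1_{(0,t]}(s)·Φ(s,t)`:
`0 ≤ Ψ(s,t) ≤ C_∞` for all `s,t ∈ [0,T]` and `∫₀ᵀ Ψ(s,t) ds ≤ C₁ τ`. -/
theorem stmt_3
    (T τ αlow : ℝ) (hT : 0 < T) (hτ : 0 < τ) (hτ1 : τ ≤ 1) (hαlow : 0 < αlow)
    (α : ℝ → ℝ)
    (hint : IntegrableOn α (Icc 0 T) volume)
    (hαge : ∀ᵐ r ∂(volume.restrict (Icc (0:ℝ) T)), αlow ≤ α r)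
    (Φ Ψ : ℝ → ℝ → ℝ)
    (hΦ : ∀ s t : ℝ, Φ s t = Real.exp (-(1/τ) * ∫ r in s..t, α r))
    (hΨ : ∀ s t : ℝ, Ψ s t = Φ s T * Φ 0 t / (1 - Φ 0 T)
      + Set.indicator (Set.Ioc (0:ℝ) t) (fun _ => (1:ℝ)) s * Φ s t)
    (Cinf C1 : ℝ)
    (hCinf : Cinf = 1 + (1 - Real.exp (-(αlow * T)))⁻¹)
    (hC1 : C1 = Cinf / αlow) :
    (∀ s ∈ Icc (0:ℝ) T, ∀ t ∈ Icc (0:ℝ) T, 0 ≤ Ψ s t ∧ Ψ s t ≤ Cinf) ∧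
    (∀ t ∈ Icc (0:ℝ) T, (∫ s in (0:ℝ)..T, Ψ s t) ≤ C1 * τ) := by
  have hk : 0 < αlow / τ := by positivity
  have hΦpos : ∀ s t, 0 < Φ s t := fun s t => by rw [hΦ]; exact Real.exp_pos _
  have hΦle : ∀ s t, 0 ≤ s → s ≤ t → t ≤ T → Φ s t ≤ Real.exp (-(αlow / τ * (t - s))) := by
    intro s t hs hst ht
    rw [hΦ, Real.exp_le_exp]
    have h := div_le_div_of_nonneg_right
      (mul_sub_le_intervalIntegral_of_ae_le hint hαge hs hst ht) hτ.le
    have e1 : -(1 / τ) * ∫ r in s..t, α r = -((∫ r in s..t, α r) / τ) := by ring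
    have e2 : αlow / τ * (t - s) = αlow * (t - s) / τ := by ring
    rw [e1, e2]
    linarith
  have hexp_le_one : ∀ s t, s ≤ t → Real.exp (-(αlow / τ * (t - s))) ≤ 1 := by
    intro s t hst
    rw [Real.exp_le_one_iff, neg_nonpos]
    exact mul_nonneg hk.le (sub_nonneg.2 hst)
  have hden : 0 < 1 - Real.exp (-(αlow * T)) := by
    rw [sub_pos, Real.exp_lt_one_iff, neg_lt_zero]
    positivity
  have hden_le : 1 - Real.exp (-(αlow * T)) ≤ 1 - Φ 0 T := by
    have h := hΦle 0 T le_rfl hT.le le_rfl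
    have h2 : Real.exp (-(αlow / τ * (T - 0))) ≤ Real.exp (-(αlow * T)) := by
      rw [Real.exp_le_exp, neg_le_neg_iff, sub_zero]
      exact mul_le_mul_of_nonneg_right (le_div_self hαlow.le hτ hτ1) hT.le
    linarith
  set D := (1 - Real.exp (-(αlow * T)))⁻¹ with hD
  have hDpos : 0 < D := inv_pos.2 hden
  have hΨnonneg : ∀ s t, 0 ≤ Ψ s t := by
    intro s t
    rw [hΨ]
    have h1 := hΦpos s T
    have h2 := hΦpos 0 t
    have h3 := hΦpos s t
    have h4 : 0 < 1 - Φ 0 T := hden.trans_le hden_le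
    have h5 : 0 ≤ Set.indicator (Set.Ioc (0:ℝ) t) (fun _ => (1:ℝ)) s :=
      indicator_nonneg (fun _ _ => zero_le_one) s
    positivity
  have hΨle : ∀ s ∈ Icc (0:ℝ) T, ∀ t ∈ Icc (0:ℝ) T, Ψ s t ≤
      D * Real.exp (-(αlow / τ * (T - s))) +
        (Ioc 0 t).indicator (fun s => Real.exp (-(αlow / τ * (t - s)))) s := by
    intro s hs t ht
    rw [hΨ]
    refine add_le_add ?_ ?_
    · have h0t : Φ 0 t ≤ 1 :=
        (hΦle 0 t le_rfl ht.1 ht.2).trans (hexp_le_one 0 t ht.1)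
      have hnum : Φ s T * Φ 0 t ≤ Real.exp (-(αlow / τ * (T - s))) :=
        (mul_le_of_le_one_right (hΦpos s T).le h0t).trans (hΦle s T hs.1 hs.2 le_rfl)
      rw [mul_comm D, hD, ← div_eq_mul_inv]
      exact div_le_div₀ (Real.exp_pos _).le hnum hden hden_le
    · by_cases hmem : s ∈ Ioc 0 t
      · simpa [indicator_of_mem hmem] using hΦle s t hs.1 hmem.2 ht.2
      · simp [indicator_of_notMem hmem]
  refine ⟨fun s hs t ht => ⟨hΨnonneg s t, (hΨle s hs t ht).trans ?_⟩, fun t ht => ?_⟩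
  · have h1 : D * Real.exp (-(αlow / τ * (T - s))) ≤ D :=
      mul_le_of_le_one_right hDpos.le (hexp_le_one s T hs.2)
    have h2 : (Ioc 0 t).indicator (fun s => Real.exp (-(αlow / τ * (t - s)))) s ≤ 1 :=
      indicator_apply_le' (fun h => hexp_le_one s t h.2) (fun _ => zero_le_one)
    rw [hCinf]
    linarith
  · have hcont : ∀ x, Continuous fun s => Real.exp (-(αlow / τ * (x - s))) := by
      intro x
      fun_prop
    have hi1 : IntegrableOn (fun s => D * Real.exp (-(αlow / τ * (T - s)))) (Ioc 0 T) :=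
      ((continuous_const.mul (hcont T)).integrableOn_Ioc)
    have hi2 : IntegrableOn
        ((Ioc 0 t).indicator fun s => Real.exp (-(αlow / τ * (t - s)))) (Ioc 0 T) :=
      (hcont t).integrableOn_Ioc.indicator measurableSet_Ioc
    have hinter : Ioc 0 T ∩ Ioc 0 t = Ioc 0 t :=
      inter_eq_right.2 (Ioc_subset_Ioc_right ht.2)
    have hIT := intervalIntegral_exp_neg_mul_sub_le hk T
    have hIt := intervalIntegral_exp_neg_mul_sub_le hk t
    rw [intervalIntegral.integral_of_le hT.le] at hIT
    rw [intervalIntegral.integral_of_le ht.1] at hIt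
    rw [intervalIntegral.integral_of_le hT.le]
    calc ∫ s in Ioc 0 T, Ψ s t
        ≤ ∫ s in Ioc 0 T, (D * Real.exp (-(αlow / τ * (T - s))) +
          (Ioc 0 t).indicator (fun s => Real.exp (-(αlow / τ * (t - s)))) s) := by
          refine integral_mono_of_nonneg (ae_of_all _ fun s => hΨnonneg s t) (hi1.add hi2) ?_
          filter_upwards [ae_restrict_mem measurableSet_Ioc] with s hs
          exact hΨle s ⟨hs.1.le, hs.2⟩ t ht
      _ = D * (∫ s in Ioc 0 T, Real.exp (-(αlow / τ * (T - s)))) +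
          ∫ s in Ioc 0 t, Real.exp (-(αlow / τ * (t - s))) := by
          rw [integral_add hi1 hi2, integral_const_mul, setIntegral_indicator measurableSet_Ioc,
            hinter]
      _ ≤ D * (1 / (αlow / τ)) + 1 / (αlow / τ) :=
          add_le_add (mul_le_mul_of_nonneg_left hIT hDpos.le) hIt
      _ = C1 * τ := by
          rw [hC1, hCinf]
          field_simp
          ring
end

section
/- Let T > 0, let α̲ > 0, and let p ∈ [1,∞). There exists a constant C > 0 depending only on α̲, T and p such that the following holds: for every τ ∈ (0,1], every continuous α : [0,T] → ℝ with α(r) ≥ α̲ for all r, every continuous h : [0,T] → ℝ, and every continuously differentiable y : [0,T] → ℝ satisfying τ y'(t) + α(t) y(t) = h(t) for all t ∈ [0,T] and the time-periodicity condition y(0) = y(T), one has ‖y‖_{L^p(0,T)} ≤ C · τ^{−1/p} · ‖h‖_{L^p(0,T)}. -/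
open MeasureTheory Set

/-- Bernoulli's inequality in homogeneous form: the tangent line of `x ↦ x ^ q` at `a`
lies below the graph. -/
lemma Real.rpow_add_mul_rpow_sub_le {a b q : ℝ} (ha : 0 ≤ a) (hb : 0 ≤ b) (hq : 1 < q) :
    a ^ q + q * a ^ (q - 1) * (b - a) ≤ b ^ q := by
  rcases ha.eq_or_lt with rfl | ha
  · rw [Real.zero_rpow (by linarith), Real.zero_rpow (by linarith)]
    simpa using Real.rpow_nonneg hb q
  have hbern := one_add_mul_self_le_rpow_one_add (s := b / a - 1)
    (by have := div_nonneg hb ha.le; linarith) hq.le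
  rw [add_sub_cancel, Real.div_rpow hb ha.le, le_div_iff₀ (Real.rpow_pos_of_pos ha q)] at hbern
  have hpow : a ^ q = a ^ (q - 1) * a := by
    rw [← Real.rpow_add_one ha.ne', sub_add_cancel]
  calc a ^ q + q * a ^ (q - 1) * (b - a) = (1 + q * (b / a - 1)) * a ^ q := by
        rw [hpow]; field_simp
    _ ≤ b ^ q := hbern

/-- Pointwise energy inequality for `d + a * z = g`, for `d` the scaled derivative. -/
lemma abs_rpow_energy_le {q c a z d g : ℝ} (hq : 1 < q) (hc : 0 < c) (hca : c ≤ a)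
    (heq : d + a * z = g) :
    c ^ q * |z| ^ q + c ^ (q - 1) * (q * |z| ^ (q - 2) * z * d) ≤ |g| ^ q := by
  have htan := Real.rpow_add_mul_rpow_sub_le (a := c * |z|) (b := |g|) (q := q)
    (by positivity) (abs_nonneg g) hq
  rw [Real.mul_rpow hc.le (abs_nonneg z), Real.mul_rpow hc.le (abs_nonneg z)] at htan
  refine le_trans ?_ htan
  rcases eq_or_ne z 0 with rfl | hz
  · simp [Real.zero_rpow (by linarith : q - 1 ≠ 0)]
  have hz' : 0 < |z| := abs_pos.2 hz
  have hpow : |z| ^ (q - 1) = |z| ^ (q - 2) * |z| := by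
    rw [← Real.rpow_add_one hz'.ne']; ring_nf
  have hkey : z * d ≤ |z| * (|g| - c * |z|) := by
    have h1 : z * g ≤ |z| * |g| := by rw [← abs_mul]; exact le_abs_self _
    have h2 : |z| * |z| = z * z := abs_mul_abs_self z
    have h3 : c * (z * z) ≤ a * (z * z) := by gcongr; exact mul_self_nonneg z
    have h4 : z * d = z * g - a * (z * z) := by rw [← heq]; ring
    have h5 : |z| * (|g| - c * |z|) = |z| * |g| - c * (|z| * |z|) := by ring
    rw [h5, h2]; linarith
  have hcoef : 0 ≤ c ^ (q - 1) * (q * |z| ^ (q - 2)) := by positivity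
  have := mul_le_mul_of_nonneg_left hkey hcoef
  rw [hpow]
  linarith

/-- Continuity in the exponent of the integral of a power, from the right at `1`. -/
lemma tendsto_integral_abs_rpow_one {T : ℝ} (hT : 0 ≤ T) {f : ℝ → ℝ}
    (hf : ContinuousOn f (Icc 0 T)) :
    Filter.Tendsto (fun q : ℝ => ∫ t in (0:ℝ)..T, |f t| ^ q) (nhdsWithin 1 (Ioi 1))
      (nhds (∫ t in (0:ℝ)..T, |f t| ^ (1:ℝ))) := by
  obtain ⟨M, hM⟩ := isCompact_Icc.exists_bound_of_continuousOn hf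
  have hIoc : Ioc (0:ℝ) 2 ∈ nhdsWithin (1:ℝ) (Ioi 1) :=
    mem_nhdsWithin_of_mem_nhds (Ioc_mem_nhds (by norm_num) (by norm_num))
  have hsub : uIoc 0 T ⊆ Icc 0 T := by
    rw [uIoc_of_le hT]; exact Ioc_subset_Icc_self
  refine intervalIntegral.tendsto_integral_filter_of_dominated_convergence
    (fun _ => (1 + M) ^ (2:ℝ)) ?_ ?_ intervalIntegrable_const ?_
  · filter_upwards [hIoc] with q hq
    exact ((hf.mono hsub).abs.rpow_const fun _ _ => Or.inr hq.1.le).aestronglyMeasurable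
      measurableSet_uIoc
  · filter_upwards [hIoc] with q hq
    refine Filter.Eventually.of_forall fun t ht => ?_
    have hMt : |f t| ≤ M := hM t (hsub ht)
    have hM0 : 0 ≤ M := (abs_nonneg _).trans hMt
    rw [Real.norm_eq_abs, abs_of_nonneg (by positivity)]
    calc |f t| ^ q ≤ (1 + M) ^ q :=
          Real.rpow_le_rpow (abs_nonneg _) (by linarith) hq.1.le
      _ ≤ (1 + M) ^ (2:ℝ) := Real.rpow_le_rpow_of_exponent_le (by linarith) hq.2
  · refine Filter.Eventually.of_forall fun t _ => ?_
    exact (Real.continuousAt_const_rpow' one_ne_zero).tendsto.mono_left nhdsWithin_le_nhds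

section Periodic

variable {T c τ : ℝ} {α h y y' : ℝ → ℝ}

/-- The `L^q` energy estimate for time-periodic solutions, for `1 < q`. -/
lemma integral_abs_rpow_le_of_periodic_of_one_lt (hT : 0 ≤ T) (hc : 0 < c)
    (hα : ∀ r ∈ Icc (0:ℝ) T, c ≤ α r) (hh : ContinuousOn h (Icc 0 T))
    (hy' : ContinuousOn y' (Icc 0 T))
    (hderiv : ∀ t ∈ Icc (0:ℝ) T, HasDerivWithinAt y (y' t) (Icc 0 T) t)
    (hode : ∀ t ∈ Icc (0:ℝ) T, τ * y' t + α t * y t = h t) (hper : y 0 = y T)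
    {q : ℝ} (hq : 1 < q) :
    c ^ q * ∫ t in (0:ℝ)..T, |y t| ^ q ≤ ∫ t in (0:ℝ)..T, |h t| ^ q := by
  have hy : ContinuousOn y (Icc 0 T) := fun t ht => (hderiv t ht).continuousWithinAt
  have hu : uIcc 0 T = Icc 0 T := uIcc_of_le hT
  have hpow {f : ℝ → ℝ} (hf : ContinuousOn f (Icc 0 T)) :
      ContinuousOn (fun t => |f t| ^ q) (Icc 0 T) :=
    hf.abs.rpow_const fun _ _ => Or.inr (by linarith)
  have hD : ContinuousOn (fun t => q * |y t| ^ (q - 2) * y t * y' t) (Icc 0 T) := by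
    have hcont : Continuous fun x : ℝ => q * |x| ^ (q - 2) * x := by
      have hd : deriv (fun x : ℝ => |x| ^ q) = fun x : ℝ => q * |x| ^ (q - 2) * x :=
        funext fun x => (hasDerivAt_abs_rpow x hq).deriv
      rw [← hd]
      have := (contDiff_norm_rpow (E := ℝ) hq).continuous_deriv le_rfl
      simpa only [Real.norm_eq_abs] using this
    exact (hcont.comp_continuousOn hy).mul hy'
  have hDint : IntervalIntegrable (fun t => q * |y t| ^ (q - 2) * y t * y' t) volume 0 T :=
    ContinuousOn.intervalIntegrable (hu ▸ hD)
  have hzero : ∫ t in (0:ℝ)..T, q * |y t| ^ (q - 2) * y t * y' t = 0 := by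
    rw [intervalIntegral.integral_eq_sub_of_hasDerivAt_of_le hT (hpow hy) _ hDint, hper, sub_self]
    intro t ht
    exact (hasDerivAt_abs_rpow (y t) hq).comp t
      ((hderiv t (Ioo_subset_Icc_self ht)).hasDerivAt (Icc_mem_nhds ht.1 ht.2))
  have hyint : IntervalIntegrable (fun t => |y t| ^ q) volume 0 T :=
    ContinuousOn.intervalIntegrable (hu ▸ hpow hy)
  have hhint : IntervalIntegrable (fun t => |h t| ^ q) volume 0 T :=
    ContinuousOn.intervalIntegrable (hu ▸ hpow hh)
  calc c ^ q * ∫ t in (0:ℝ)..T, |y t| ^ q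
      = ∫ t in (0:ℝ)..T, (c ^ q * |y t| ^ q
          + c ^ (q - 1) * τ * (q * |y t| ^ (q - 2) * y t * y' t)) := by
        rw [intervalIntegral.integral_add (hyint.const_mul _) (hDint.const_mul _),
          intervalIntegral.integral_const_mul, intervalIntegral.integral_const_mul, hzero,
          mul_zero, add_zero]
    _ ≤ ∫ t in (0:ℝ)..T, |h t| ^ q := by
        refine intervalIntegral.integral_mono_on hT
          ((hyint.const_mul _).add (hDint.const_mul _)) hhint fun t ht => ?_
        have := abs_rpow_energy_le hq hc (hα t ht) (hode t ht)
        linarith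

/-- The `L^p` energy estimate for time-periodic solutions, for `1 ≤ p`. -/
lemma integral_abs_rpow_le_of_periodic (hT : 0 ≤ T) (hc : 0 < c)
    (hα : ∀ r ∈ Icc (0:ℝ) T, c ≤ α r) (hh : ContinuousOn h (Icc 0 T))
    (hy' : ContinuousOn y' (Icc 0 T))
    (hderiv : ∀ t ∈ Icc (0:ℝ) T, HasDerivWithinAt y (y' t) (Icc 0 T) t)
    (hode : ∀ t ∈ Icc (0:ℝ) T, τ * y' t + α t * y t = h t) (hper : y 0 = y T)
    {p : ℝ} (hp : 1 ≤ p) :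
    c ^ p * ∫ t in (0:ℝ)..T, |y t| ^ p ≤ ∫ t in (0:ℝ)..T, |h t| ^ p := by
  rcases hp.eq_or_lt with rfl | hp
  · have hy : ContinuousOn y (Icc 0 T) := fun t ht => (hderiv t ht).continuousWithinAt
    have hcq : Filter.Tendsto (fun q : ℝ => c ^ q) (nhdsWithin 1 (Ioi 1)) (nhds (c ^ (1:ℝ))) :=
      (Real.continuousAt_const_rpow hc.ne').tendsto.mono_left nhdsWithin_le_nhds
    refine le_of_tendsto_of_tendsto (hcq.mul (tendsto_integral_abs_rpow_one hT hy))
      (tendsto_integral_abs_rpow_one hT hh) ?_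
    filter_upwards [self_mem_nhdsWithin] with q hq
    exact integral_abs_rpow_le_of_periodic_of_one_lt hT hc hα hh hy' hderiv hode hper hq
  · exact integral_abs_rpow_le_of_periodic_of_one_lt hT hc hα hh hy' hderiv hode hper hp

end Periodic

/-- uniform-in-`τ` `L^p` estimate for time-periodic solutions of the
relaxation ODE `τ y' + α y = h`: `‖y‖_{L^p(0,T)} ≤ C τ^{−1/p} ‖h‖_{L^p(0,T)}`. -/
theorem stmt_5
    (T αlow p : ℝ) (hT : 0 < T) (hαlow : 0 < αlow) (hp : 1 ≤ p) :
    ∃ C > (0:ℝ), ∀ τ ∈ Ioc (0:ℝ) 1, ∀ α h y y' : ℝ → ℝ,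
      ContinuousOn α (Icc 0 T) →
      (∀ r ∈ Icc (0:ℝ) T, αlow ≤ α r) →
      ContinuousOn h (Icc 0 T) →
      ContinuousOn y' (Icc 0 T) →
      (∀ t ∈ Icc (0:ℝ) T, HasDerivWithinAt y (y' t) (Icc 0 T) t) →
      (∀ t ∈ Icc (0:ℝ) T, τ * y' t + α t * y t = h t) →
      y 0 = y T →
      (∫ t in (0:ℝ)..T, |y t| ^ p) ^ (1 / p)
        ≤ C * τ ^ (-(1 / p)) * (∫ t in (0:ℝ)..T, |h t| ^ p) ^ (1 / p) := by
  refine ⟨αlow⁻¹, inv_pos.2 hαlow, ?_⟩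
  intro τ hτ α h y y' _ hα hh hy' hderiv hode hper
  have hp0 : 0 < p := by linarith
  have hnonneg (f : ℝ → ℝ) : 0 ≤ ∫ t in (0:ℝ)..T, |f t| ^ p :=
    intervalIntegral.integral_nonneg hT.le fun t _ => by positivity
  have hmain := Real.rpow_le_rpow (mul_nonneg (by positivity) (hnonneg y))
    (integral_abs_rpow_le_of_periodic hT.le hαlow hα hh hy' hderiv hode hper hp)
    (by positivity : 0 ≤ 1 / p)
  rw [Real.mul_rpow (by positivity) (hnonneg y), ← Real.rpow_mul hαlow.le,
    mul_one_div_cancel hp0.ne', Real.rpow_one] at hmain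
  have hτ1 : 1 ≤ τ ^ (-(1 / p)) :=
    Real.one_le_rpow_of_pos_of_le_one_of_nonpos hτ.1 hτ.2 (by simp [hp0.le])
  calc (∫ t in (0:ℝ)..T, |y t| ^ p) ^ (1 / p)
      ≤ αlow⁻¹ * (∫ t in (0:ℝ)..T, |h t| ^ p) ^ (1 / p) := (le_inv_mul_iff₀ hαlow).2 hmain
    _ ≤ αlow⁻¹ * τ ^ (-(1 / p)) * (∫ t in (0:ℝ)..T, |h t| ^ p) ^ (1 / p) := by
        have := hnonneg h
        gcongr
        exact le_mul_of_one_le_right (by positivity) hτ1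
end
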